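/- Let $(\bm{x}_t)_{t=1}^T$ be vectors in $\mathbb{R}^d$ with $\|\bm{x}_t\|_2 \le a$ for all $t$, and let $V_t = \lambda I + \sum_{s=1}^t \bm{x}_s \bm{x}_s^\top$ for some $\lambda > 0$. Then $\sum_{t=1}^T \min\{1, \bm{x}_t^\top V_{t-1}^{-1} \bm{x}_t\} \le 2d \log(1 + a^2 T/(d\lambda))$. -/

import Mathlib

open Matrix

lemma ep_min_le (u : ℝ) (hu : 0 ≤ u) : min 1 u ≤ 2 * Real.log (1 + u) := by
  have h := Real.one_sub_inv_le_log_of_pos (show 0 < 1 + u by linarith)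
  have h2 : min 1 u / 2 ≤ 1 - (1 + u)⁻¹ := by
    have : 1 - (1 + u)⁻¹ = u / (1 + u) := by field_simp; ring
    rw [this, div_le_div_iff₀ (by norm_num) (by linarith)]
    rcases le_total 1 u with h | h
    · rw [min_eq_left h]; linarith
    · rw [min_eq_right h]; nlinarith
  linarith

lemma ep_log_le (μ c : ℝ) (hμ : 0 < μ) (hc : 0 < c) : Real.log μ ≤ μ / c - 1 + Real.log c := by
  have h := Real.log_le_sub_one_of_pos (div_pos hμ hc)
  rw [Real.log_div hμ.ne' hc.ne'] at h
  linarith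

lemma ep_logdet {d : ℕ} (V : Matrix (Fin d) (Fin d) ℝ) (hV : V.PosDef) (c : ℝ) (hc : 0 < c) :
    Real.log V.det ≤ V.trace / c - d + d * Real.log c := by
  have h1 := hV.isHermitian.det_eq_prod_eigenvalues
  have h2 := hV.isHermitian.trace_eq_sum_eigenvalues
  simp only [RCLike.ofReal_real_eq_id, id_eq] at h1 h2
  rw [h1, h2, Real.log_prod (fun i _ => (hV.eigenvalues_pos i).ne'), Finset.sum_div]
  calc _ ≤ ∑ i, (hV.isHermitian.eigenvalues i / c - 1 + Real.log c) :=
        Finset.sum_le_sum fun i _ => ep_log_le _ _ (hV.eigenvalues_pos i) hc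
    _ = _ := by simp [Finset.sum_add_distrib, Finset.sum_sub_distrib]

lemma ep_step {d : ℕ} (V : Matrix (Fin d) (Fin d) ℝ) (hV : V.PosDef) (x : Fin d → ℝ) :
    min 1 (x ⬝ᵥ (V⁻¹ *ᵥ x)) ≤
      2 * (Real.log (V + vecMulVec x x).det - Real.log V.det) := by
  have hu : 0 ≤ x ⬝ᵥ (V⁻¹ *ᵥ x) := by
    simpa using hV.inv.posSemidef.dotProduct_mulVec_nonneg x
  have hdet : (V + vecMulVec x x).det = V.det * (1 + x ⬝ᵥ (V⁻¹ *ᵥ x)) := by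
    have h := det_add_replicateCol_mul_replicateRow (ι := Unit) (A := V) hV.det_pos.ne'.isUnit x x
    rw [vecMulVec_eq Unit, h]
    congr 1
    rw [det_unique, Matrix.mul_assoc, ← replicateCol_mulVec]
    simp [-replicateCol_mulVec, Matrix.mul_apply, dotProduct]
  rw [hdet, Real.log_mul hV.det_pos.ne' (by linarith)]
  linarith [ep_min_le _ hu]

theorem stmt8 (d T : ℕ) (hd : 0 < d) (a lam : ℝ) (ha : 0 ≤ a) (hlam : 0 < lam)
    (x : ℕ → Fin d → ℝ) (hx : ∀ t, x t ⬝ᵥ x t ≤ a ^ 2) :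
    ∑ t ∈ Finset.range T,
        min 1 (x t ⬝ᵥ
          (((lam • (1 : Matrix (Fin d) (Fin d) ℝ)
              + ∑ s ∈ Finset.range t, vecMulVec (x s) (x s))⁻¹) *ᵥ x t))
      ≤ 2 * d * Real.log (1 + a ^ 2 * T / (d * lam)) := by
  set V : ℕ → Matrix (Fin d) (Fin d) ℝ := fun t =>
    lam • (1 : Matrix (Fin d) (Fin d) ℝ) + ∑ s ∈ Finset.range t, vecMulVec (x s) (x s) with hVdef
  have hV : ∀ t, (V t).PosDef := fun t =>
    (PosDef.one.smul hlam).add_posSemidef (posSemidef_sum _ fun s _ => by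
      simpa using posSemidef_vecMulVec_self_star (x s))
  have hsucc : ∀ t, V (t + 1) = V t + vecMulVec (x t) (x t) := fun t => by
    simp only [hVdef, Finset.sum_range_succ, add_assoc]
  have hsum : ∑ t ∈ Finset.range T, min 1 (x t ⬝ᵥ ((V t)⁻¹ *ᵥ x t)) ≤
      2 * (Real.log (V T).det - Real.log (V 0).det) := by
    rw [← Finset.sum_range_sub (fun t => Real.log (V t).det), Finset.mul_sum]
    refine Finset.sum_le_sum fun t _ => ?_
    rw [hsucc]
    exact ep_step _ (hV t) _
  refine hsum.trans ?_
  have h0 : Real.log (V 0).det = d * Real.log lam := by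
    simp [hVdef, det_smul]
  have hd' : (0 : ℝ) < d := by exact_mod_cast hd
  have htr : (V T).trace ≤ d * lam + T * a ^ 2 := by
    simp only [hVdef, trace_add, trace_smul, trace_one, trace_sum, trace_vecMulVec]
    have := Finset.sum_le_sum (s := Finset.range T) fun t _ => hx t
    simp at this ⊢
    linarith
  have hc : 0 < lam + a ^ 2 * T / d := by positivity
  have h1 := ep_logdet (V T) (hV T) _ hc
  have h2 : (V T).trace / (lam + a ^ 2 * T / d) ≤ d := by
    rw [div_le_iff₀ hc]
    have : d * (lam + a ^ 2 * T / d) = d * lam + T * a ^ 2 := by field_simp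
    linarith
  have h3 : 1 + a ^ 2 * T / (d * lam) = (lam + a ^ 2 * T / d) / lam := by field_simp
  rw [h3, Real.log_div hc.ne' hlam.ne', h0]
  linarith
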